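/- arXiv:2404.10235 — 6 statements merged into one kernel-verified Lean document; each statement's English description precedes it below -/
import Mathlib

section
/- Let u and v be unit vectors in the Euclidean plane ℝ² whose angle θ = arccos⟨u, v⟩ satisfies 0 ≤ θ < π/3 or 2π/3 < θ ≤ π. Then there exists a unit vector w in ℝ² such that |⟨u, w⟩| < 1/2 and |⟨v, w⟩| < 1/2, i.e., the pair of devices has a sensing blind region: some target motion direction is observed with |cos ξ| < 1/2 by both devices. -/
open Real
open scoped RealInnerProductSpace

lemma blind_aux (u v : EuclideanSpace ℝ (Fin 2)) (hu : ‖u‖ = 1) (hv : ‖v‖ = 1)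
    (h : 1 / 2 < ⟪u, v⟫) :
    ∃ w : EuclideanSpace ℝ (Fin 2), ‖w‖ = 1 ∧
      |⟪u, w⟫| < 1 / 2 ∧ |⟪v, w⟫| < 1 / 2 := by
  have hu2 : u 0 ^ 2 + u 1 ^ 2 = 1 := by
    have := EuclideanSpace.real_norm_sq_eq u
    rw [hu, Fin.sum_univ_two] at this
    linarith
  have hv2 : v 0 ^ 2 + v 1 ^ 2 = 1 := by
    have := EuclideanSpace.real_norm_sq_eq v
    rw [hv, Fin.sum_univ_two] at this
    linarith
  have hin : ∀ x y : EuclideanSpace ℝ (Fin 2), ⟪x, y⟫ = x 0 * y 0 + x 1 * y 1 := by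
    intro x y
    simp [PiLp.inner_apply, Fin.sum_univ_two, mul_comm]
  rw [hin] at h
  obtain ⟨n, hn0, hn2⟩ : ∃ n : ℝ, 0 < n ∧ n ^ 2 = (u 0 + v 0) ^ 2 + (u 1 + v 1) ^ 2 := by
    have hp : 0 < (u 0 + v 0) ^ 2 + (u 1 + v 1) ^ 2 := by nlinarith
    exact ⟨_, Real.sqrt_pos.2 hp, Real.sq_sqrt hp.le⟩
  have hcross : (u 1 * v 0 - u 0 * v 1) ^ 2 < (n / 2) ^ 2 := by
    have e : (u 1 * v 0 - u 0 * v 1) ^ 2 = 1 - (u 0 * v 0 + u 1 * v 1) ^ 2 := by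
      linear_combination (v 0 ^ 2 + v 1 ^ 2) * hu2 + hv2
    have e2 : n ^ 2 = 2 + 2 * (u 0 * v 0 + u 1 * v 1) := by
      linear_combination hn2 + hu2 + hv2
    rw [e]
    nlinarith
  have hc := abs_lt.1 (abs_lt_of_sq_lt_sq hcross (by positivity))
  refine ⟨!₂[-(u 1 + v 1) / n, (u 0 + v 0) / n], ?_, ?_, ?_⟩
  · rw [← sq_eq_sq₀ (norm_nonneg _) zero_le_one, EuclideanSpace.real_norm_sq_eq, Fin.sum_univ_two]
    simp only [PiLp.toLp_apply, Matrix.cons_val_zero, Matrix.cons_val_one]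
    field_simp
    linarith
  · rw [hin]
    have : u 0 * (!₂[-(u 1 + v 1) / n, (u 0 + v 0) / n] : EuclideanSpace ℝ (Fin 2)) 0
        + u 1 * (!₂[-(u 1 + v 1) / n, (u 0 + v 0) / n] : EuclideanSpace ℝ (Fin 2)) 1
        = (u 1 * v 0 - u 0 * v 1) / n := by
      simp only [PiLp.toLp_apply, Matrix.cons_val_zero, Matrix.cons_val_one]
      field_simp
      ring
    rw [this, abs_div, abs_of_pos hn0, div_lt_iff₀ hn0, abs_lt]
    constructor <;> linarith [hc.1, hc.2]
  · rw [hin]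
    have : v 0 * (!₂[-(u 1 + v 1) / n, (u 0 + v 0) / n] : EuclideanSpace ℝ (Fin 2)) 0
        + v 1 * (!₂[-(u 1 + v 1) / n, (u 0 + v 0) / n] : EuclideanSpace ℝ (Fin 2)) 1
        = -(u 1 * v 0 - u 0 * v 1) / n := by
      simp only [PiLp.toLp_apply, Matrix.cons_val_zero, Matrix.cons_val_one]
      field_simp
      ring
    rw [this, abs_div, abs_of_pos hn0, div_lt_iff₀ hn0, abs_lt]
    constructor <;> linarith [hc.1, hc.2]

/-- If two unit line-of-sight directions `u, v` in the Euclidean plane have angle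
`θ = arccos ⟪u, v⟫` with `0 ≤ θ < π/3` or `2π/3 < θ ≤ π`, then there exists a unit
motion direction `w` observed with `|cos ξ| < 1/2` by both devices (a sensing blind region). -/
theorem two_device_blind_region (u v : EuclideanSpace ℝ (Fin 2))
    (hu : ‖u‖ = 1) (hv : ‖v‖ = 1)
    (hθ : (0 ≤ Real.arccos ⟪u, v⟫ ∧ Real.arccos ⟪u, v⟫ < π / 3) ∨
          (2 * π / 3 < Real.arccos ⟪u, v⟫ ∧ Real.arccos ⟪u, v⟫ ≤ π)) :
    ∃ w : EuclideanSpace ℝ (Fin 2), ‖w‖ = 1 ∧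
      |⟪u, w⟫| < 1 / 2 ∧ |⟪v, w⟫| < 1 / 2 := by
  have hb := abs_le.1 (abs_real_inner_le_norm u v)
  rw [hu, hv, one_mul] at hb
  have hcos := Real.cos_arccos hb.1 hb.2
  have hpi := Real.pi_pos
  rcases hθ with ⟨h0, h1⟩ | ⟨h0, h1⟩
  · apply blind_aux u v hu hv
    have := Real.cos_lt_cos_of_nonneg_of_le_pi h0 (by linarith) h1
    rw [hcos, Real.cos_pi_div_three] at this
    exact this
  · have h2 := Real.cos_lt_cos_of_nonneg_of_le_pi (by positivity) h1 h0
    rw [hcos, show 2 * π / 3 = π - π / 3 by ring, Real.cos_pi_sub,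
      Real.cos_pi_div_three] at h2
    obtain ⟨w, hw, a, b⟩ := blind_aux u (-v) hu (by rw [norm_neg, hv])
      (by rw [inner_neg_right]; linarith)
    refine ⟨w, hw, a, ?_⟩
    rwa [inner_neg_left, abs_neg] at b
end

section
/- Let u and v be unit vectors in the Euclidean plane ℝ² with angle θ = arccos⟨u, v⟩ ∈ [0, π]. Then the minimum over all unit vectors w in ℝ² of max(|⟨u, w⟩|, |⟨v, w⟩|) equals min(sin(θ/2), cos(θ/2)). In particular this minimum is at least 1/2 if and only if π/3 ≤ θ ≤ 2π/3. -/
open Real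
open scoped RealInnerProductSpace

lemma aux_inner (x y : EuclideanSpace ℝ (Fin 2)) : ⟪x, y⟫ = x 0 * y 0 + x 1 * y 1 := by
  simp [PiLp.inner_apply, Fin.sum_univ_two]
  ring

lemma aux_norm (x : EuclideanSpace ℝ (Fin 2)) : ‖x‖ = 1 ↔ x 0 ^ 2 + x 1 ^ 2 = 1 := by
  rw [EuclideanSpace.norm_eq, Real.sqrt_eq_one]
  simp [Fin.sum_univ_two]

/-- The two bisector directions `e`, `f` of a pair of plane unit vectors. -/
lemma aux_frame (p q r t s c : ℝ) (hu : p ^ 2 + q ^ 2 = 1) (hv : r ^ 2 + t ^ 2 = 1)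
    (h1 : s ^ 2 + c ^ 2 = 1) (hC : p * r + q * t = c ^ 2 - s ^ 2) :
    ∃ e0 e1 f0 f1 S : ℝ, S ^ 2 = s ^ 2 ∧ e0 ^ 2 + e1 ^ 2 = 1 ∧ f0 = e1 ∧ f1 = -e0 ∧
      p = c * e0 + S * f0 ∧ q = c * e1 + S * f1 ∧
      r = c * e0 - S * f0 ∧ t = c * e1 - S * f1 := by
  have hD : (p * t - q * r) ^ 2 = (2 * s * c) ^ 2 := by
    have h2 : (p * t - q * r) ^ 2 = (p ^ 2 + q ^ 2) * (r ^ 2 + t ^ 2) - (p * r + q * t) ^ 2 := by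
      ring
    have h3 : (s ^ 2 + c ^ 2) ^ 2 = 1 := by rw [h1]; norm_num
    rw [h2, hu, hv, hC]; linear_combination -h3
  obtain ⟨S, hS, hSD⟩ : ∃ S : ℝ, S ^ 2 = s ^ 2 ∧ p * t - q * r = 2 * S * c := by
    rcases sq_eq_sq_iff_eq_or_eq_neg.mp hD with h | h
    · exact ⟨s, rfl, h⟩
    · exact ⟨-s, by ring, by rw [h]; ring⟩
  have h1' : S ^ 2 + c ^ 2 = 1 := by rw [hS, h1]
  have hC' : p * r + q * t = c ^ 2 - S ^ 2 := by rw [hS, hC]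
  refine ⟨c * p - S * q, c * q + S * p, c * q + S * p, -(c * p - S * q), S, hS, ?_, rfl, rfl,
    ?_, ?_, ?_, ?_⟩
  · linear_combination (S ^ 2 + c ^ 2) * hu + h1'
  · linear_combination -p * h1'
  · linear_combination -q * h1'
  · linear_combination -r * hu + p * hC' - q * hSD
  · linear_combination -t * hu + q * hC' + p * hSD

/-- For unit vectors `u, v` in the plane with angle `θ = arccos ⟪u, v⟫`, the minimum over
unit vectors `w` of `max (|⟪u, w⟫|, |⟪v, w⟫|)` equals `min (sin (θ/2)) (cos (θ/2))`;
and this minimum is `≥ 1/2` iff `π/3 ≤ θ ≤ 2π/3`. -/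
theorem min_max_abs_inner_eq (u v : EuclideanSpace ℝ (Fin 2))
    (hu : ‖u‖ = 1) (hv : ‖v‖ = 1) :
    IsLeast {x : ℝ | ∃ w : EuclideanSpace ℝ (Fin 2), ‖w‖ = 1 ∧
        x = max |⟪u, w⟫| |⟪v, w⟫|}
      (min (Real.sin (Real.arccos ⟪u, v⟫ / 2)) (Real.cos (Real.arccos ⟪u, v⟫ / 2))) ∧
    ((1 : ℝ) / 2 ≤
        min (Real.sin (Real.arccos ⟪u, v⟫ / 2)) (Real.cos (Real.arccos ⟪u, v⟫ / 2)) ↔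
      π / 3 ≤ Real.arccos ⟪u, v⟫ ∧ Real.arccos ⟪u, v⟫ ≤ 2 * π / 3) := by
  have hle := abs_le.mp (by simpa [hu, hv] using abs_real_inner_le_norm u v : |⟪u, v⟫| ≤ 1)
  have hcos := Real.cos_arccos hle.1 hle.2
  have h0 := Real.arccos_nonneg ⟪u, v⟫
  have hpi := Real.arccos_le_pi ⟪u, v⟫
  have hpos := Real.pi_pos
  set θ := Real.arccos ⟪u, v⟫ with hθ
  have hs : 0 ≤ Real.sin (θ / 2) := Real.sin_nonneg_of_nonneg_of_le_pi (by linarith) (by linarith)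
  have hc : 0 ≤ Real.cos (θ / 2) := Real.cos_nonneg_of_neg_pi_div_two_le_of_le (by linarith) (by linarith)
  constructor
  · have h1 := Real.sin_sq_add_cos_sq (θ / 2)
    have hC : ⟪u, v⟫ = Real.cos (θ / 2) ^ 2 - Real.sin (θ / 2) ^ 2 := by
      rw [← hcos, ← Real.cos_two_mul']; congr 1; ring
    generalize Real.sin (θ / 2) = s at *
    generalize Real.cos (θ / 2) = c at *
    rw [aux_inner] at hC
    rw [aux_norm] at hu hv
    obtain ⟨e0, e1, f0, f1, S, hS, he, hf0, hf1, hp, hq, hr, ht⟩ :=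
      aux_frame _ _ _ _ s c hu hv h1 hC
    subst hf0 hf1
    have hSs : |S| = s := by rw [(sq_eq_sq_iff_abs_eq_abs _ _).mp hS, abs_of_nonneg hs]
    constructor
    · rcases le_total s c with h | h
      · refine ⟨!₂[f0, -e0], ?_, ?_⟩
        · rw [aux_norm]; simp; linarith
        · rw [aux_inner, aux_inner, min_eq_left h, hp, hq, hr, ht]
          simp only [PiLp.toLp_apply, Matrix.cons_val_zero, Matrix.cons_val_one]
          have a1 : (c * e0 + S * f0) * f0 + (c * f0 + S * -e0) * -e0 = S := by
            linear_combination S * he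
          have a2 : (c * e0 - S * f0) * f0 + (c * f0 - S * -e0) * -e0 = -S := by
            linear_combination -S * he
          rw [a1, a2, abs_neg, max_self, hSs]
      · refine ⟨!₂[e0, f0], ?_, ?_⟩
        · rw [aux_norm]; simpa using he
        · rw [aux_inner, aux_inner, min_eq_right h, hp, hq, hr, ht]
          simp only [PiLp.toLp_apply, Matrix.cons_val_zero, Matrix.cons_val_one]
          have a1 : (c * e0 + S * f0) * e0 + (c * f0 + S * -e0) * f0 = c := by
            linear_combination c * he
          have a2 : (c * e0 - S * f0) * e0 + (c * f0 - S * -e0) * f0 = c := by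
            linear_combination c * he
          rw [a1, a2, max_self, abs_of_nonneg hc]
    · rintro x ⟨w, hw, rfl⟩
      rw [aux_norm] at hw
      rw [aux_inner, aux_inner, hp, hq, hr, ht]
      set A := (c * e0 + S * f0) * w 0 + (c * f0 + S * -e0) * w 1 with hA
      set B := (c * e0 - S * f0) * w 0 + (c * f0 - S * -e0) * w 1 with hB
      set X := e0 * w 0 + f0 * w 1 with hX
      set Y := f0 * w 0 - e0 * w 1 with hY
      have hXY : X ^ 2 + Y ^ 2 = 1 := by
        rw [hX, hY]; linear_combination (w 0 ^ 2 + w 1 ^ 2) * he + hw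
      have hAB : A ^ 2 + B ^ 2 = 2 * (c ^ 2 * X ^ 2 + s ^ 2 * Y ^ 2) := by
        rw [← hS, hA, hB, hX, hY]; ring
      have hm0 : 0 ≤ min s c := le_min hs hc
      have hms : min s c ^ 2 ≤ s ^ 2 := pow_le_pow_left₀ hm0 (min_le_left _ _) 2
      have hmc : min s c ^ 2 ≤ c ^ 2 := pow_le_pow_left₀ hm0 (min_le_right _ _) 2
      generalize min s c = m at *
      have k1 := mul_le_mul_of_nonneg_right hmc (sq_nonneg X)
      have k2 := mul_le_mul_of_nonneg_right hms (sq_nonneg Y)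
      have k3 : m ^ 2 * X ^ 2 + m ^ 2 * Y ^ 2 = m ^ 2 := by linear_combination m ^ 2 * hXY
      by_contra hlt
      obtain ⟨l1, l2⟩ := max_lt_iff.mp (not_le.mp hlt)
      have q1 : A ^ 2 < m ^ 2 := sq_lt_sq.mpr (by rwa [abs_of_nonneg hm0])
      have q2 : B ^ 2 < m ^ 2 := sq_lt_sq.mpr (by rwa [abs_of_nonneg hm0])
      linarith
  · rw [le_min_iff]
    apply and_congr
    · rw [← Real.sin_pi_div_six, Real.strictMonoOn_sin.le_iff_le
        ⟨by linarith, by linarith⟩ ⟨by linarith, by linarith⟩]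
      constructor <;> intro h <;> linarith
    · rw [← Real.cos_pi_div_three, Real.strictAntiOn_cos.le_iff_ge
        ⟨by linarith, by linarith⟩ ⟨by linarith, by linarith⟩]
      constructor <;> intro h <;> linarith
end

section
/- Let I be a finite index set and for each i ∈ I let u_i be a unit vector in the Euclidean plane ℝ². Suppose M is a finite collection of pairwise disjoint (unordered) pairs {i, j} of distinct indices from I such that for every pair {i, j} ∈ M the angle between u_i and u_j lies in [π/3, 2π/3]. Then for every unit vector w in ℝ², the number of indices i ∈ I with |⟨u_i, w⟩| ≥ 1/2 is at least the number of pairs in M. -/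
open Real
open scoped RealInnerProductSpace

theorem good_of_pair (a b w : EuclideanSpace ℝ (Fin 2)) (ha : ‖a‖ = 1) (hb : ‖b‖ = 1)
    (hw : ‖w‖ = 1) (h1 : π / 3 ≤ Real.arccos ⟪a, b⟫) (h2 : Real.arccos ⟪a, b⟫ ≤ 2 * π / 3) :
    (1 : ℝ) / 2 ≤ |⟪a, w⟫| ∨ (1 : ℝ) / 2 ≤ |⟪b, w⟫| := by
  have hab : |⟪a, b⟫| ≤ 1 := by
    have := abs_real_inner_le_norm a b
    rwa [ha, hb, one_mul] at this
  have hcos := Real.cos_arccos (abs_le.1 hab).1 (abs_le.1 hab).2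
  have hpi := Real.pi_pos
  have hc1 : ⟪a, b⟫ ≤ 1 / 2 := by
    rw [← hcos, ← Real.cos_pi_div_three]
    exact Real.cos_le_cos_of_nonneg_of_le_pi (by positivity) (Real.arccos_le_pi _) h1
  have hc2 : -(1 / 2) ≤ ⟪a, b⟫ := by
    have h3 : Real.cos (2 * π / 3) = -(1 / 2) := by
      rw [← Real.cos_pi_div_three, ← Real.cos_pi_sub]
      congr 1
      ring
    rw [← hcos, ← h3]
    exact Real.cos_le_cos_of_nonneg_of_le_pi (Real.arccos_nonneg _) (by linarith) h2
  have ea := real_inner_self_eq_norm_sq a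
  have eb := real_inner_self_eq_norm_sq b
  have ew := real_inner_self_eq_norm_sq w
  rw [ha] at ea
  rw [hb] at eb
  rw [hw] at ew
  have gram : ⟪a, a⟫ * ⟪b, b⟫ * ⟪w, w⟫ + 2 * ⟪a, w⟫ * ⟪b, w⟫ * ⟪a, b⟫
      - ⟪a, a⟫ * ⟪b, w⟫ ^ 2 - ⟪b, b⟫ * ⟪a, w⟫ ^ 2 - ⟪w, w⟫ * ⟪a, b⟫ ^ 2 = (0 : ℝ) := by
    simp only [PiLp.inner_apply, Fin.sum_univ_two, RCLike.inner_apply, conj_trivial]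
    ring
  rw [ea, eb, ew] at gram
  by_contra! hcon
  obtain ⟨hx, hy⟩ := hcon
  generalize (⟪a, w⟫ : ℝ) = x at *
  generalize (⟪b, w⟫ : ℝ) = y at *
  generalize (⟪a, b⟫ : ℝ) = c at *
  have hc : |c| ≤ 1 / 2 := abs_le.2 ⟨hc2, hc1⟩
  have x2 : x ^ 2 < 1 / 4 := by
    rw [← sq_abs]; nlinarith [abs_nonneg x]
  have y2 : y ^ 2 < 1 / 4 := by
    rw [← sq_abs]; nlinarith [abs_nonneg y]
  have c2 : c ^ 2 ≤ 1 / 4 := by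
    rw [← sq_abs]; nlinarith [abs_nonneg c]
  have hxy : |x * y| ≤ 1 / 4 := by
    rw [abs_mul]; nlinarith [abs_nonneg x, abs_nonneg y]
  have hxyc : |x * y * c| ≤ 1 / 8 := by
    rw [abs_mul]; nlinarith [abs_nonneg (x * y), abs_nonneg c]
  have := neg_abs_le (x * y * c)
  nlinarith

/-- If `M` is a collection of pairwise disjoint pairs of distinct devices, each pair having
intersection angle in `[π/3, 2π/3]`, then for any unit motion direction `w` the number of
devices with `|⟪u_i, w⟫| ≥ 1/2` is at least the number of pairs in `M`. -/
theorem matching_lower_bounds_good_views {I : Type*} [Fintype I]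
    (u : I → EuclideanSpace ℝ (Fin 2)) (hu : ∀ i, ‖u i‖ = 1)
    (M : Finset (Sym2 I))
    (hdiag : ∀ e ∈ M, ¬ e.IsDiag)
    (hdisj : ∀ e ∈ M, ∀ e' ∈ M, e ≠ e' → ∀ i : I, i ∈ e → i ∉ e')
    (hangle : ∀ i j : I, s(i, j) ∈ M →
      π / 3 ≤ Real.arccos ⟪u i, u j⟫ ∧ Real.arccos ⟪u i, u j⟫ ≤ 2 * π / 3) :
    ∀ w : EuclideanSpace ℝ (Fin 2), ‖w‖ = 1 →
      M.card ≤ {i : I | (1 : ℝ) / 2 ≤ |⟪u i, w⟫|}.ncard := by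
  intro w hw
  have key : ∀ e : Sym2 I, ∃ i ∈ e, e ∈ M → (1 : ℝ) / 2 ≤ |⟪u i, w⟫| := by
    intro e
    induction e using Sym2.ind with
    | _ i j =>
      by_cases he : s(i, j) ∈ M
      · rcases good_of_pair (u i) (u j) w (hu i) (hu j) hw (hangle i j he).1 (hangle i j he).2
          with h | h
        · exact ⟨i, Sym2.mem_mk_left i j, fun _ => h⟩
        · exact ⟨j, Sym2.mem_mk_right i j, fun _ => h⟩
      · exact ⟨i, Sym2.mem_mk_left i j, fun h => absurd h he⟩
  choose f hf hg using key
  rw [← Set.ncard_coe_finset]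
  refine Set.ncard_le_ncard_of_injOn f (fun e he => hg e he) ?_ (Set.toFinite _)
  intro e he e' he' hee
  by_contra hne
  exact hdisj e he e' he' hne (f e) (hf e) (hee ▸ hf e')
end

section
/- Let G be a simple graph on a finite vertex set V and let A be a real V × V matrix that is skew-symmetric (Aᵀ = −A) and supported on the edges of G, i.e., A_{ij} ≠ 0 implies that i and j are adjacent in G. Then the rank of A is at most twice the maximum matching number ν(G) of G, i.e., rank(A) ≤ 2·ν(G). -/
open Matrix

/-- The matching number `ν(G)` of a simple graph on a finite vertex set: the maximum
cardinality of a set of pairwise vertex-disjoint edges of `G`. -/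
noncomputable def matchingNumber {V : Type*} [Fintype V] (G : SimpleGraph V) : ℕ :=
  sSup {n : ℕ | ∃ M : Finset (Sym2 V), (∀ e ∈ M, e ∈ G.edgeSet) ∧
    (∀ e ∈ M, ∀ e' ∈ M, e ≠ e' → ∀ v : V, v ∈ e → v ∉ e') ∧ M.card = n}


/-- The principal block of `A` on `S` is nonsingular. -/
def NonsingOn {V : Type*} [Fintype V] (A : Matrix V V ℝ) (S : Finset V) : Prop :=
  ∀ x : V → ℝ, (∀ i, i ∉ S → x i = 0) → (∀ i ∈ S, (A *ᵥ x) i = 0) → x = 0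

theorem skew_dot {V : Type*} [Fintype V] (A : Matrix V V ℝ) (hskew : Aᵀ = -A)
    (x y : V → ℝ) : y ⬝ᵥ (A *ᵥ x) = -(x ⬝ᵥ (A *ᵥ y)) := by
  rw [Matrix.dotProduct_mulVec, ← Matrix.mulVec_transpose, hskew, Matrix.neg_mulVec,
    neg_dotProduct, dotProduct_comm]

theorem NonsingOn.solve {V : Type*} [Fintype V] [DecidableEq V] {A : Matrix V V ℝ}
    {S : Finset V} (h : NonsingOn A S) (i : V) (hi : i ∈ S) :
    ∃ y : V → ℝ, (∀ k, k ∉ S → y k = 0) ∧ ∀ k ∈ S, (A *ᵥ y) k = if k = i then 1 else 0 := by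
  let L : (V → ℝ) →ₗ[ℝ] (V → ℝ) :=
    { toFun := fun x k => if k ∈ S then (A *ᵥ x) k else x k
      map_add' := by
        intro x y; ext k; by_cases hk : k ∈ S <;> simp [hk, Matrix.mulVec_add]
      map_smul' := by
        intro c x; ext k; by_cases hk : k ∈ S <;> simp [hk, Matrix.mulVec_smul] }
  have hL : ∀ x k, L x k = if k ∈ S then (A *ᵥ x) k else x k := fun _ _ => rfl
  have hinj : Function.Injective L := by
    rw [← LinearMap.ker_eq_bot, LinearMap.ker_eq_bot']
    intro x hx
    apply h x
    · intro k hk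
      have := congrFun hx k
      simpa [hL, hk] using this
    · intro k hk
      have := congrFun hx k
      simpa [hL, hk] using this
  obtain ⟨y, hy⟩ := LinearMap.injective_iff_surjective.mp hinj
    (fun k => if k = i then 1 else 0)
  refine ⟨y, ?_, ?_⟩
  · intro k hk
    have := congrFun hy k
    have hne : k ≠ i := fun e => hk (e ▸ hi)
    simpa [hL, hk, hne] using this
  · intro k hk
    have := congrFun hy k
    simpa [hL, hk] using this

theorem exists_matching {V : Type*} [Fintype V] [DecidableEq V]
    (G : SimpleGraph V) (A : Matrix V V ℝ) (hskew : Aᵀ = -A)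
    (hsupp : ∀ i j : V, A i j ≠ 0 → G.Adj i j) (n : ℕ) :
    ∀ S : Finset V, S.card = n → NonsingOn A S →
      ∃ M : Finset (Sym2 V), (∀ e ∈ M, e ∈ G.edgeSet) ∧
        (∀ e ∈ M, ∀ e' ∈ M, e ≠ e' → ∀ v : V, v ∈ e → v ∉ e') ∧
        (∀ e ∈ M, ∀ v ∈ e, v ∈ S) ∧ S.card = 2 * M.card := by
  induction n using Nat.strong_induction_on with
  | _ n ih =>
  intro S hS h
  rcases S.eq_empty_or_nonempty with rfl | ⟨i, hi⟩
  · exact ⟨∅, by simp⟩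
  obtain ⟨y, hy0, hy⟩ := h.solve i hi
  have key : ∀ x : V → ℝ, (∀ k, k ∉ S → x k = 0) → x ⬝ᵥ (A *ᵥ y) = x i := by
    intro x hx
    rw [dotProduct, Finset.sum_eq_single i]
    · rw [hy i hi]; simp
    · intro k _ hk
      by_cases hkS : k ∈ S
      · rw [hy k hkS]; simp [hk]
      · rw [hx k hkS]; simp
    · simp
  have hyi : y i = 0 := by
    have h1 := skew_dot A hskew y y
    rw [key y hy0] at h1
    linarith
  obtain ⟨j, hj⟩ : ∃ j, A i j * y j ≠ 0 := by
    by_contra! hc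
    have h1 := hy i hi
    simp [Matrix.mulVec, dotProduct, hc] at h1
  have hAij : A i j ≠ 0 := left_ne_zero_of_mul hj
  have hyj : y j ≠ 0 := right_ne_zero_of_mul hj
  have hadj := hsupp i j hAij
  have hjS : j ∈ S := by
    by_contra hc
    exact hyj (hy0 j hc)
  have hij : i ≠ j := hadj.ne
  have hjS' : j ∈ S.erase i := Finset.mem_erase.mpr ⟨hij.symm, hjS⟩
  have hc1 := Finset.card_erase_add_one hi
  have hc2 := Finset.card_erase_add_one hjS'
  have hmem : ∀ k, k ∈ (S.erase i).erase j ↔ k ≠ j ∧ k ≠ i ∧ k ∈ S := by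
    intro k; simp [Finset.mem_erase]
  have hns : NonsingOn A ((S.erase i).erase j) := by
    intro x hx0 hx
    have hxS : ∀ k, k ∉ S → x k = 0 := fun k hk =>
      hx0 k (fun hc => hk ((hmem k).1 hc).2.2)
    have hxi : x i = 0 := hx0 i (fun hc => ((hmem i).1 hc).2.1 rfl)
    have hxj : x j = 0 := hx0 j (fun hc => ((hmem j).1 hc).1 rfl)
    have hb : (A *ᵥ x) j = 0 := by
      have h1 := skew_dot A hskew x y
      rw [key x hxS, hxi, dotProduct, Finset.sum_eq_single j] at h1
      · simpa [hyj] using h1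
      · intro k _ hk
        by_cases hkS : k ∈ S
        · by_cases hki : k = i
          · rw [hki, hyi]; simp
          · rw [hx k ((hmem k).2 ⟨hk, hki, hkS⟩)]; simp
        · rw [hy0 k hkS]; simp
      · simp
    have hz : x - (A *ᵥ x) i • y = 0 := by
      apply h
      · intro k hk; simp [hxS k hk, hy0 k hk]
      · intro k hk
        rw [Matrix.mulVec_sub, Matrix.mulVec_smul]
        simp only [Pi.sub_apply, Pi.smul_apply, smul_eq_mul, hy k hk]
        by_cases hki : k = i
        · simp [hki]
        · by_cases hkj : k = j
          · rw [hkj, hb]; simp [hij.symm]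
          · rw [hx k ((hmem k).2 ⟨hkj, hki, hk⟩)]; simp [hki]
    have ha : (A *ᵥ x) i = 0 := by
      have h1 := congrFun hz j
      simpa [hxj, hyj] using h1
    simpa [ha] using hz
  obtain ⟨M, hM1, hM2, hM3, hM4⟩ := ih _ (by omega) ((S.erase i).erase j) rfl hns
  have hnew : ∀ e ∈ M, ∀ v ∈ e, v ∉ s(i, j) := by
    intro e he v hv hv'
    have h1 := (hmem v).1 (hM3 e he v hv)
    rcases Sym2.mem_iff.1 hv' with h2 | h2
    · exact h1.2.1 h2
    · exact h1.1 h2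
  have hnot : s(i, j) ∉ M := fun hc => hnew _ hc i (Sym2.mem_mk_left i j) (Sym2.mem_mk_left i j)
  refine ⟨insert s(i, j) M, ?_, ?_, ?_, ?_⟩
  · intro e he
    rcases Finset.mem_insert.1 he with rfl | he
    · exact hadj
    · exact hM1 e he
  · intro e he e' he' hne v hv hv'
    rcases Finset.mem_insert.1 he with rfl | he
    · rcases Finset.mem_insert.1 he' with rfl | he'
      · exact hne rfl
      · exact hnew e' he' v hv' hv
    · rcases Finset.mem_insert.1 he' with rfl | he'
      · exact hnew e he v hv hv'
      · exact hM2 e he e' he' hne v hv hv'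
  · intro e he v hv
    rcases Finset.mem_insert.1 he with rfl | he
    · rcases Sym2.mem_iff.1 hv with rfl | rfl
      · exact hi
      · exact hjS
    · exact ((hmem v).1 (hM3 e he v hv)).2.2
  · rw [Finset.card_insert_of_notMem hnot]; omega

theorem exists_nonsingOn {V : Type*} [Fintype V] [DecidableEq V]
    (A : Matrix V V ℝ) (hskew : Aᵀ = -A) :
    ∃ S : Finset V, S.card = A.rank ∧ NonsingOn A S := by
  obtain ⟨κ, a, ha, hspan, hli⟩ := exists_linearIndependent' ℝ A.row
  have : Finite κ := Finite.of_injective a ha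
  have : Fintype κ := Fintype.ofFinite κ
  refine ⟨Finset.univ.image a, ?_, ?_⟩
  · rw [Finset.card_image_of_injective _ ha, Finset.card_univ, Matrix.rank_eq_finrank_span_row,
      ← hspan, finrank_span_eq_card hli]
  · intro x hx0 hx
    have hall : ∀ v ∈ Submodule.span ℝ (Set.range A.row), v ⬝ᵥ x = 0 := by
      rw [← hspan]
      intro v hv
      induction hv using Submodule.span_induction with
      | mem v hv =>
        obtain ⟨k, rfl⟩ := hv
        exact hx (a k) (by simp)
      | zero => simp
      | add u v _ _ hu hv => rw [add_dotProduct, hu, hv, add_zero]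
      | smul c u _ hu => rw [smul_dotProduct, hu, smul_zero]
    have hAx : A *ᵥ x = 0 := by
      ext k
      exact hall (A.row k) (Submodule.subset_span ⟨k, rfl⟩)
    have hxA : x ᵥ* A = 0 := by
      rw [← Matrix.mulVec_transpose, hskew, Matrix.neg_mulVec, hAx, neg_zero]
    have hsum : ∑ k : κ, x (a k) • (A.row ∘ a) k = 0 := by
      ext l
      have h1 := congrFun hxA l
      simp only [Matrix.vecMul, dotProduct] at h1
      rw [← Finset.sum_subset (Finset.subset_univ (Finset.univ.image a)),
        Finset.sum_image (fun _ _ _ _ e => ha e)] at h1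
      · simpa [Finset.sum_apply] using h1
      · intro k _ hk
        rw [hx0 k hk, zero_mul]
    have h0 := Fintype.linearIndependent_iff.1 hli (fun k => x (a k)) hsum
    ext k
    by_cases hk : k ∈ Finset.univ.image a
    · obtain ⟨l, _, rfl⟩ := Finset.mem_image.1 hk
      exact h0 l
    · exact hx0 k hk

/-- A real skew-symmetric matrix supported on the edges of a simple graph `G` has rank at
most twice the maximum matching number of `G`. -/
theorem rank_le_two_mul_matchingNumber {V : Type*} [Fintype V] [DecidableEq V]
    (G : SimpleGraph V) (A : Matrix V V ℝ)
    (hskew : Aᵀ = -A)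
    (hsupp : ∀ i j : V, A i j ≠ 0 → G.Adj i j) :
    A.rank ≤ 2 * matchingNumber G := by
  obtain ⟨S, hS, hns⟩ := exists_nonsingOn A hskew
  obtain ⟨M, hM1, hM2, -, hM4⟩ := exists_matching G A hskew hsupp _ S rfl hns
  rw [← hS, hM4]
  refine Nat.mul_le_mul_left 2 (le_csSup ⟨Fintype.card (Sym2 V), ?_⟩ ⟨M, hM1, hM2, rfl⟩)
  rintro n ⟨M', -, -, rfl⟩
  exact Finset.card_le_univ M'
end

section
/- Let Q be a finite index set with a linear order, and for each i ∈ Q let u_i be a unit vector in the Euclidean plane ℝ². Define the real Q × Q matrix T by: T_{ij} = 1 if i < j and the angle between u_i and u_j lies in [π/3, 2π/3]; T_{ij} = −1 if i > j and the angle between u_i and u_j lies in [π/3, 2π/3]; and T_{ij} = 0 otherwise. Then for every unit vector w in ℝ², the number of indices i ∈ Q with |⟨u_i, w⟩| ≥ 1/2 is at least (1/2)·rank(T). (This is the deterministic core of Proposition 1: no matter in which direction the target moves, at least (1/2)·rank(T) of the qualified devices observe the target with aspect angle satisfying |cos ξ_i| ≥ 1/2.) -/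
open Real
open scoped RealInnerProductSpace

lemma bad_pair_geom (a b w : EuclideanSpace ℝ (Fin 2)) (ha : ‖a‖ = 1) (hb : ‖b‖ = 1)
    (hw : ‖w‖ = 1) (hp : |⟪a, w⟫| < 1 / 2) (hq : |⟪b, w⟫| < 1 / 2) :
    ¬ (π / 3 ≤ Real.arccos ⟪a, b⟫ ∧ Real.arccos ⟪a, b⟫ ≤ 2 * π / 3) := by
  rintro ⟨h1, h2⟩
  have hc : |⟪a, b⟫| ≤ 1 := by
    have := abs_real_inner_le_norm a b
    simpa [ha, hb] using this
  obtain ⟨hc1, hc2⟩ := abs_le.mp hc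
  have hcos := Real.cos_arccos hc1 hc2
  have e1 : ⟪a, b⟫ ≤ 1 / 2 := by
    rw [← hcos, ← Real.cos_pi_div_three]
    exact Real.cos_le_cos_of_nonneg_of_le_pi (by positivity) (Real.arccos_le_pi _) h1
  have e2 : -(1 / 2) ≤ ⟪a, b⟫ := by
    have h : Real.cos (2 * π / 3) = -(1 / 2) := by
      rw [show 2 * π / 3 = π - π / 3 by ring, Real.cos_pi_sub, Real.cos_pi_div_three]
    rw [← hcos, ← h]
    exact Real.cos_le_cos_of_nonneg_of_le_pi (Real.arccos_nonneg _)
      (by linarith [Real.pi_pos]) h2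
  have key : ⟪a, b⟫ ^ 2 - 2 * ⟪a, b⟫ * ⟪a, w⟫ * ⟪b, w⟫ + ⟪a, w⟫ ^ 2 + ⟪b, w⟫ ^ 2 = 1 := by
    have na : ⟪a, a⟫ = 1 := by rw [real_inner_self_eq_norm_sq, ha]; norm_num
    have nb : ⟪b, b⟫ = 1 := by rw [real_inner_self_eq_norm_sq, hb]; norm_num
    have nw : ⟪w, w⟫ = 1 := by rw [real_inner_self_eq_norm_sq, hw]; norm_num
    -- Gram determinant of three plane vectors vanishes
    have gram : ⟪a, a⟫ * ⟪b, b⟫ * ⟪w, w⟫ + 2 * ⟪a, b⟫ * ⟪a, w⟫ * ⟪b, w⟫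
        - ⟪a, b⟫ ^ 2 * ⟪w, w⟫ - ⟪a, w⟫ ^ 2 * ⟪b, b⟫ - ⟪b, w⟫ ^ 2 * ⟪a, a⟫ = 0 := by
      simp only [PiLp.inner_apply, Fin.sum_univ_two, RCLike.inner_apply, conj_trivial]
      ring
    rw [na, nb, nw] at gram
    linarith
  have c2 : |⟪a, b⟫| ≤ 1 / 2 := abs_le.mpr ⟨e2, e1⟩
  generalize ⟪a, b⟫ = c at *
  generalize ⟪a, w⟫ = p at *
  generalize ⟪b, w⟫ = q at *
  have s1 : c ^ 2 ≤ 1 / 4 := by rw [← sq_abs]; nlinarith [abs_nonneg c]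
  have s2 : p ^ 2 < 1 / 4 := by rw [← sq_abs]; nlinarith [abs_nonneg p]
  have s3 : q ^ 2 < 1 / 4 := by rw [← sq_abs]; nlinarith [abs_nonneg q]
  have s4 : |p * q| ≤ 1 / 4 := by
    rw [abs_mul]; nlinarith [abs_nonneg p, abs_nonneg q]
  have s5 : |c * (p * q)| ≤ 1 / 8 := by
    rw [abs_mul]; nlinarith [abs_nonneg c, abs_nonneg (p * q)]
  have s6 := (abs_le.mp s5).1
  nlinarith

lemma rank_le_two_mul_of_zero_block {Q : Type*} [Fintype Q] [DecidableEq Q]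
    (T : Matrix Q Q ℝ) (G : Set Q) (h : ∀ i j, i ∉ G → j ∉ G → T i j = 0) :
    T.rank ≤ 2 * G.ncard := by
  classical
  let d : Q → ℝ := fun i => if i ∈ G then 1 else 0
  let D : Matrix Q Q ℝ := Matrix.diagonal d
  let e : Q → ℝ := fun i => if i ∈ G then 0 else 1
  have hD : D.rank = G.ncard := by
    rw [Matrix.rank_diagonal, ← Nat.card_coe_set_eq, ← Nat.card_eq_fintype_card]
    apply Nat.card_congr
    apply Equiv.subtypeEquivRight
    intro i
    simp [d]
  have hdec : T = D * T + (Matrix.diagonal e * T) * D := by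
    ext i j
    simp only [D, Matrix.add_apply, Matrix.diagonal_mul, Matrix.mul_diagonal, d, e]
    by_cases hi : i ∈ G <;> by_cases hj : j ∈ G <;> simp [hi, hj, h]
  have h1 : (D * T).rank ≤ D.rank := Matrix.rank_mul_le_left _ _
  have h2 : ((Matrix.diagonal e * T) * D).rank ≤ D.rank := Matrix.rank_mul_le_right _ _
  have h3 : (D * T + (Matrix.diagonal e * T) * D).rank ≤
      (D * T).rank + ((Matrix.diagonal e * T) * D).rank := by
    generalize D * T = A
    generalize (Matrix.diagonal e * T) * D = B
    unfold Matrix.rank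
    rw [Matrix.mulVecLin_add]
    refine (Submodule.finrank_mono (t := LinearMap.range A.mulVecLin ⊔ LinearMap.range B.mulVecLin) ?_).trans
      (Submodule.finrank_add_le_finrank_add_finrank _ _)
    rintro _ ⟨x, rfl⟩
    exact Submodule.add_mem_sup ⟨x, rfl⟩ ⟨x, rfl⟩
  rw [← hdec] at h3
  omega

open scoped Classical in
/-- Deterministic core of Proposition 1: with `T` the skew-symmetric ±1 matrix recording
pairs of qualified devices whose intersection angle lies in `[π/3, 2π/3]`, for every unit
motion direction `w` at least `(1/2)·rank T` devices satisfy `|⟪u_i, w⟫| ≥ 1/2`. -/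
theorem half_rank_T_le_good_views {Q : Type*} [Fintype Q] [LinearOrder Q]
    (u : Q → EuclideanSpace ℝ (Fin 2)) (hu : ∀ i, ‖u i‖ = 1)
    (T : Matrix Q Q ℝ)
    (hT : ∀ i j : Q, T i j =
      if i < j ∧ π / 3 ≤ Real.arccos ⟪u i, u j⟫ ∧ Real.arccos ⟪u i, u j⟫ ≤ 2 * π / 3
      then 1
      else if j < i ∧ π / 3 ≤ Real.arccos ⟪u i, u j⟫ ∧ Real.arccos ⟪u i, u j⟫ ≤ 2 * π / 3
      then -1
      else 0) :
    ∀ w : EuclideanSpace ℝ (Fin 2), ‖w‖ = 1 →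
      (T.rank : ℝ) / 2 ≤ (({i : Q | (1 : ℝ) / 2 ≤ |⟪u i, w⟫|}.ncard : ℝ)) := by
  intro w hw
  have h := rank_le_two_mul_of_zero_block T {i : Q | (1 : ℝ) / 2 ≤ |⟪u i, w⟫|} (by
    intro i j hi hj
    simp only [Set.mem_ofPred_eq, not_le] at hi hj
    have hb := bad_pair_geom (u i) (u j) w (hu i) (hu j) hw hi hj
    rw [hT, if_neg (fun h => hb h.2), if_neg (fun h => hb h.2)])
  have h' : (T.rank : ℝ) ≤ 2 * (({i : Q | (1 : ℝ) / 2 ≤ |⟪u i, w⟫|}.ncard : ℝ)) := by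
    exact_mod_cast h
  linarith
end

section
/- Fix n ∈ ℕ, a threshold γ ∈ ℕ, and real numbers p, q with 0 ≤ p ≤ q ≤ 1. For z ∈ {0, 1, …, n} define g(z) = Σ over k ∈ {0, …, z} and m ∈ {0, …, n − z} with k + m < γ of C(z, k)·C(n − z, m)·p^k·(1 − p)^{z − k}·q^m·(1 − q)^{n − z − m}, where C(·,·) denotes the binomial coefficient. Then g is nondecreasing in z: for every z with 0 ≤ z < n, g(z) ≤ g(z + 1). (Interpretation: with z detectors of error probability p and n − z detectors of larger error probability q = λp, the probability that fewer than γ detectors err — hence the γ-voting fusion accuracy Θ — is monotonically increasing in the number z of low-error detectors.) -/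
/-- `g n γ p q z` is the probability that fewer than `γ` detectors err, when `z` detectors
err independently with probability `p` and the other `n - z` with probability `q`. -/
noncomputable def fusionAccuracy (n γ : ℕ) (p q : ℝ) (z : ℕ) : ℝ :=
  ∑ k ∈ Finset.range (z + 1), ∑ m ∈ Finset.range (n - z + 1),
    if k + m < γ then
      (z.choose k : ℝ) * ((n - z).choose m : ℝ) *
        p ^ k * (1 - p) ^ (z - k) * q ^ m * (1 - q) ^ (n - z - m)
    else 0

/-- One Bernoulli step of a binomial average. -/
theorem binom_step (z : ℕ) (p : ℝ) (F : ℕ → ℝ) :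
    ∑ k ∈ Finset.range (z + 1 + 1),
        ((z + 1).choose k : ℝ) * p ^ k * (1 - p) ^ (z + 1 - k) * F k =
      ∑ k ∈ Finset.range (z + 1),
        (z.choose k : ℝ) * p ^ k * (1 - p) ^ (z - k) * ((1 - p) * F k + p * F (k + 1)) := by
  have h1 : ∑ k ∈ Finset.range (z + 1),
        (z.choose k : ℝ) * p ^ k * (1 - p) ^ (z - k) * ((1 - p) * F k) =
      ∑ k ∈ Finset.range (z + 1 + 1),
        (z.choose k : ℝ) * p ^ k * (1 - p) ^ (z + 1 - k) * F k := by
    rw [Finset.sum_range_succ _ (z + 1)]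
    simp only [Nat.choose_succ_self, Nat.cast_zero, zero_mul, add_zero]
    refine Finset.sum_congr rfl fun k hk => ?_
    have hk' : k ≤ z := Nat.lt_succ_iff.mp (Finset.mem_range.mp hk)
    rw [Nat.succ_sub hk', pow_succ]
    ring
  simp only [mul_add]
  rw [Finset.sum_add_distrib, h1, Finset.sum_range_succ', Finset.sum_range_succ' _ (z + 1),
    add_right_comm, ← Finset.sum_add_distrib]
  congr 1
  · refine Finset.sum_congr rfl fun k _ => ?_
    rw [Nat.choose_succ_succ, Nat.add_sub_add_right]
    push_cast
    ring
  · simp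

/-- With error probabilities `0 ≤ p ≤ q ≤ 1`, the `γ`-voting fusion accuracy is
monotonically nondecreasing in the number `z` of low-error detectors. -/
theorem fusionAccuracy_monotone (n γ : ℕ) (p q : ℝ)
    (hp : 0 ≤ p) (hpq : p ≤ q) (hq : q ≤ 1)
    (z : ℕ) (hz : z < n) :
    fusionAccuracy n γ p q z ≤ fusionAccuracy n γ p q (z + 1) := by
  obtain ⟨w, rfl⟩ : ∃ w, n = z + (w + 1) := ⟨n - z - 1, by omega⟩
  have e1 : z + (w + 1) - z = w + 1 := by omega
  have e2 : z + (w + 1) - (z + 1) = w := by omega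
  let F : ℕ → ℝ := fun j => if j < γ then 1 else 0
  have hF : ∀ j, F (j + 1) ≤ F j := by
    intro j
    simp only [F]
    split_ifs <;> first | omega | norm_num
  have L : fusionAccuracy (z + (w + 1)) γ p q z =
      ∑ k ∈ Finset.range (z + 1), (z.choose k : ℝ) * p ^ k * (1 - p) ^ (z - k) *
        ∑ m ∈ Finset.range (w + 1), (w.choose m : ℝ) * q ^ m * (1 - q) ^ (w - m) *
          ((1 - q) * F (k + m) + q * F (k + m + 1)) := by
    unfold fusionAccuracy
    rw [e1]
    refine Finset.sum_congr rfl fun k _ => ?_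
    have h := binom_step w q (fun m => F (k + m))
    simp only [← add_assoc] at h
    rw [← h, Finset.mul_sum]
    refine Finset.sum_congr rfl fun m _ => ?_
    simp only [F]
    split_ifs <;> ring
  have R : fusionAccuracy (z + (w + 1)) γ p q (z + 1) =
      ∑ k ∈ Finset.range (z + 1), (z.choose k : ℝ) * p ^ k * (1 - p) ^ (z - k) *
        ∑ m ∈ Finset.range (w + 1), (w.choose m : ℝ) * q ^ m * (1 - q) ^ (w - m) *
          ((1 - p) * F (k + m) + p * F (k + m + 1)) := by
    unfold fusionAccuracy
    rw [e2]
    have h := binom_step z p (fun k => ∑ m ∈ Finset.range (w + 1),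
      (w.choose m : ℝ) * q ^ m * (1 - q) ^ (w - m) * F (k + m))
    trans
    · trans
      swap
      · exact h
      · refine Finset.sum_congr rfl fun k _ => ?_
        rw [Finset.mul_sum]
        refine Finset.sum_congr rfl fun m _ => ?_
        simp only [F]
        split_ifs <;> ring
    · refine Finset.sum_congr rfl fun k _ => ?_
      congr 1
      rw [Finset.mul_sum, Finset.mul_sum, ← Finset.sum_add_distrib]
      refine Finset.sum_congr rfl fun m _ => ?_
      rw [add_right_comm k 1 m]
      ring
  rw [L, R]
  have hp1 : 0 ≤ 1 - p := by linarith
  have hq0 : 0 ≤ q := by linarith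
  have hq1 : 0 ≤ 1 - q := by linarith
  refine Finset.sum_le_sum fun k _ => mul_le_mul_of_nonneg_left ?_ (by positivity)
  refine Finset.sum_le_sum fun m _ => mul_le_mul_of_nonneg_left ?_ (by positivity)
  nlinarith [mul_nonneg (sub_nonneg.2 hpq) (sub_nonneg.2 (hF (k + m)))]
end
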